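/- Let I, J be two k-element subsets of {1,...,n}, let K = I \ J and L = J \ I, and let r = |K| = |L|. Then for the Plücker coordinates (maximal minors) of any k×n real matrix A, the identity Δ_J(A) · Δ_I(A)^{r-1} = Σ_{π: K → L} (-1)^{xing(π)} Π_{i ∈ K} Δ_{(I \ {i}) ∪ {π(i)}}(A) holds, where the sum is over all bijections π from K to L. -/

import Mathlib

/-- The maximal minor of a `k × n` matrix `A` in the column set `I` (defined to be `0`
if `I` does not have exactly `k` elements). -/
noncomputable def pminor {k n : ℕ} (A : Matrix (Fin k) (Fin n) ℝ) (I : Finset (Fin n)) : ℝ :=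
  if h : I.card = k then (A.submatrix id (fun j => ((I.orderIsoOfFin h j : Fin n)))).det else 0

/-- `c` lies strictly inside the (clockwise) cyclic arc from `a` to `b` on a circle with
points labelled `0, 1, …, n-1` clockwise. -/
def cyclicBetween {n : ℕ} (a c b : Fin n) : Prop :=
  (a < c ∧ c < b) ∨ (c < b ∧ b < a) ∨ (b < a ∧ a < c)

/-- The chords `[b_a, b_b]` and `[b_c, b_d]` cross inside the circle:
exactly one of `c`, `d` lies in the open arc from `a` to `b`. -/
def chordsCross {n : ℕ} (a b c d : Fin n) : Prop :=
  Xor' (cyclicBetween a c b) (cyclicBetween a d b)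


/-- Sign of the comparison of two points. -/
noncomputable def cmpSgn {n : ℕ} (x y : Fin n) : ℝ :=
  if x < y then 1 else if y < x then -1 else 0

/-- Inversion sign of a word. -/
noncomputable def wordSgn {k n : ℕ} (f : Fin k → Fin n) : ℝ :=
  ∏ j, ∏ i ∈ Finset.Iio j, cmpSgn (f i) (f j)

theorem cmpSgn_anti {n : ℕ} (x y : Fin n) : cmpSgn x y = - cmpSgn y x := by
  unfold cmpSgn
  rcases lt_trichotomy x y with h | h | h
  · simp [h, h.not_gt]
  · simp [h]
  · simp [h, h.not_gt]

theorem cmpSgn_sq {n : ℕ} (x y : Fin n) (h : x ≠ y) : cmpSgn x y * cmpSgn x y = 1 := by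
  unfold cmpSgn
  rcases lt_or_gt_of_ne h with h | h
  · simp [h]
  · simp [h, h.not_gt]

theorem cmpSgn_lt {n : ℕ} {x y : Fin n} (h : x < y) : cmpSgn x y = 1 := by
  simp [cmpSgn, h]

theorem wordSgn_comp {k n : ℕ} (f : Fin k → Fin n) (σ : Equiv.Perm (Fin k)) :
    wordSgn (f ∘ σ) = (Equiv.Perm.sign σ : ℤ) * wordSgn f :=
  Equiv.Perm.prod_Iio_comp_eq_sign_mul_prod σ (f := fun i j => cmpSgn (f i) (f j))
    (fun _ _ => cmpSgn_anti _ _)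

theorem wordSgn_strictMono {k n : ℕ} (f : Fin k → Fin n) (hf : StrictMono f) :
    wordSgn f = 1 := by
  unfold wordSgn
  refine Finset.prod_eq_one fun j _ => Finset.prod_eq_one fun i hi => ?_
  exact cmpSgn_lt (hf (Finset.mem_Iio.1 hi))

theorem wordSgn_sq {k n : ℕ} (f : Fin k → Fin n) (hf : Function.Injective f) :
    wordSgn f * wordSgn f = 1 := by
  unfold wordSgn
  rw [← Finset.prod_mul_distrib]
  refine Finset.prod_eq_one fun j _ => ?_
  rw [← Finset.prod_mul_distrib]
  refine Finset.prod_eq_one fun i hi => ?_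
  exact cmpSgn_sq _ _ (hf.ne (Finset.mem_Iio.1 hi).ne)

theorem pminor_eq {k n : ℕ} (A : Matrix (Fin k) (Fin n) ℝ) (S : Finset (Fin n))
    (h : S.card = k) : pminor A S = (A.submatrix id (S.orderEmbOfFin h)).det := by
  unfold pminor
  rw [dif_pos h]
  rfl

/-- A column-selected determinant versus the sorted minor. -/
theorem pminor_eq_word {k n : ℕ} (A : Matrix (Fin k) (Fin n) ℝ) (S : Finset (Fin n))
    (f : Fin k → Fin n) (hf : Function.Injective f) (hS : Finset.univ.image f = S) :
    pminor A S = wordSgn f * (A.submatrix id f).det := by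
  have h : S.card = k := by
    rw [← hS, Finset.card_image_of_injective _ hf]; simp
  have hmem : ∀ i, f i ∈ S := fun i => by rw [← hS]; simp
  let g : Fin k → Fin k := fun i => (S.orderIsoOfFin h).symm ⟨f i, hmem i⟩
  have hg : Function.Injective g := by
    intro i j hij
    have := (S.orderIsoOfFin h).symm.injective hij
    exact hf (by simpa using this)
  let σ : Equiv.Perm (Fin k) := Equiv.ofBijective g (Finite.injective_iff_bijective.1 hg)
  have hfs : f = (S.orderEmbOfFin h) ∘ σ := by
    funext i
    change f i = ((S.orderIsoOfFin h ((S.orderIsoOfFin h).symm ⟨f i, hmem i⟩) : S) : Fin n)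
    simp
  have hdet : (A.submatrix id f).det = (Equiv.Perm.sign σ : ℤ) * pminor A S := by
    rw [pminor_eq A S h, ← Matrix.det_permute' σ]
    conv_lhs => rw [hfs]
    rfl
  have hw : wordSgn f = (Equiv.Perm.sign σ : ℤ) := by
    conv_lhs => rw [hfs]
    rw [wordSgn_comp, wordSgn_strictMono _ (S.orderEmbOfFin h).strictMono, mul_one]
  rw [hdet, ← hw, ← mul_assoc, wordSgn_sq f hf, one_mul]

theorem cross_sign {n : ℕ} (x y x' y' : Fin n) (h : x < y) (h1 : x' ≠ y') (h2 : x ≠ x')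
    (h3 : x ≠ y') (h4 : y ≠ x') (h5 : y ≠ y') [Decidable (chordsCross x x' y y')] :
    cmpSgn x' y' * (cmpSgn x' y * cmpSgn x y') =
      if chordsCross x x' y y' then -1 else 1 := by
  simp only [cmpSgn, chordsCross, cyclicBetween, Xor', Xor, Fin.lt_def, ne_eq, Fin.ext_iff] at *
  split_ifs <;> first | omega | norm_num

/-- The key sign computation. `pos` gives positions in `I` of the elements of a subset `K`. -/
theorem sign_identity {k n : ℕ} {T : Type*} [Fintype T] (a b : Fin k → Fin n)
    (ha : StrictMono a) (hb : Function.Injective b)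
    (pos : T → Fin k) (hpos : Function.Injective pos)
    (hfix : ∀ q, q ∉ Set.range pos → b q = a q)
    (hmv : ∀ t q, a q ≠ b (pos t))
    [DecidablePred (fun p : T × T => a (pos p.1) < a (pos p.2) ∧
      chordsCross (a (pos p.1)) (b (pos p.1)) (a (pos p.2)) (b (pos p.2)))] :
    wordSgn b * ∏ t, wordSgn (Function.update a (pos t) (b (pos t))) =
      (-1 : ℝ) ^ (Finset.univ.filter (fun p : T × T => a (pos p.1) < a (pos p.2) ∧
      chordsCross (a (pos p.1)) (b (pos p.1)) (a (pos p.2)) (b (pos p.2)))).card := by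
  classical
  have h1 : ∏ t, wordSgn (Function.update a (pos t) (b (pos t))) =
      ∏ q, wordSgn (Function.update a q (b q)) := by
    refine Fintype.prod_of_injective pos hpos _ _ ?_ (fun _ => rfl)
    intro q hq
    rw [hfix q hq, Function.update_eq_self]
    exact wordSgn_strictMono a ha
  have h2 : ∏ q, wordSgn (Function.update a q (b q)) =
      ∏ j, ∏ i ∈ Finset.Iio j, (cmpSgn (b i) (a j) * cmpSgn (a i) (b j)) := by
    unfold wordSgn
    rw [Finset.prod_comm]
    refine Finset.prod_congr rfl fun j _ => ?_
    rw [Finset.prod_comm]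
    refine Finset.prod_congr rfl fun i hi => ?_
    have hij : i < j := Finset.mem_Iio.1 hi
    have : ∀ q, cmpSgn (Function.update a q (b q) i) (Function.update a q (b q) j) =
        (if q = i then cmpSgn (b i) (a j) else 1) * (if q = j then cmpSgn (a i) (b j) else 1) := by
      intro q
      by_cases hqi : q = i
      · subst hqi
        simp [hij.ne, hij.ne']
      · by_cases hqj : q = j
        · subst hqj
          simp [hij.ne, hij.ne']
        · simp [hqi, hqj, Ne.symm hqi, Ne.symm hqj, cmpSgn_lt (ha hij), Function.update_of_ne]
    simp_rw [this]
    rw [Finset.prod_mul_distrib]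
    simp
  let G : Fin k × Fin k → ℝ := fun p =>
    if p.1 < p.2 then cmpSgn (b p.1) (b p.2) * (cmpSgn (b p.1) (a p.2) * cmpSgn (a p.1) (b p.2))
    else 1
  have h3 : wordSgn b * ∏ q, wordSgn (Function.update a q (b q)) = ∏ p, G p := by
    rw [h2]
    unfold wordSgn
    rw [← Finset.prod_mul_distrib, Fintype.prod_prod_type_right]
    refine Finset.prod_congr rfl fun j _ => ?_
    rw [← Finset.prod_mul_distrib]
    simp only [G]
    rw [← Finset.prod_filter]
    refine Finset.prod_congr ?_ fun _ _ => rfl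
    ext i; simp
  rw [h1, h3, ← Finset.prod_const, Finset.prod_filter]
  symm
  refine Fintype.prod_of_injective (Prod.map pos pos) (hpos.prodMap hpos) _ _ ?_ ?_
  · rintro ⟨i, j⟩ hp
    simp only [G]
    split_ifs with hij
    swap
    · rfl
    by_cases hi : i ∈ Set.range pos
    · by_cases hj : j ∈ Set.range pos
      · obtain ⟨s, rfl⟩ := hi
        obtain ⟨t, rfl⟩ := hj
        exact absurd ⟨(s, t), rfl⟩ hp
      · obtain ⟨s, rfl⟩ := hi
        rw [hfix j hj, cmpSgn_lt (ha hij), mul_one]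
        exact cmpSgn_sq _ _ (hmv s j).symm
    · rw [hfix i hi, cmpSgn_lt (ha hij), one_mul]
      by_cases hj : j ∈ Set.range pos
      · obtain ⟨t, rfl⟩ := hj
        exact cmpSgn_sq _ _ (hmv t i)
      · rw [hfix j hj, cmpSgn_lt (ha hij), one_mul]
  · rintro ⟨s, t⟩
    simp only [G, Prod.map]
    by_cases hst : pos s < pos t
    · have := cross_sign (a (pos s)) (a (pos t)) (b (pos s)) (b (pos t)) (ha hst)
        (hb.ne hst.ne) (hmv _ _) (hmv _ _) (hmv _ _) (hmv _ _)
      simp [hst, this, ha.lt_iff_lt]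
    · simp [hst, ha.lt_iff_lt]

/-- Determinantal identity, unsorted version. -/
theorem det_identity {k n : ℕ} {T : Type*} [Fintype T] [DecidableEq T]
    (A : Matrix (Fin k) (Fin n) ℝ) (a b : Fin k → Fin n)
    (p : Fin k → Prop) [DecidablePred p] (e : T ≃ {q // p q})
    (hfix : ∀ q, ¬ p q → b q = a q) (hT : 0 < Fintype.card T)
    (hd : (A.submatrix id a).det ≠ 0) :
    (A.submatrix id b).det * (A.submatrix id a).det ^ (Fintype.card T - 1) =
      ∑ σ : Equiv.Perm T, ((Equiv.Perm.sign σ : ℤ) : ℝ) *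
        ∏ t, (A.submatrix id (Function.update a (e t) (b (e (σ t))))).det := by
  set M := A.submatrix id a with hM
  let B : Matrix (Fin k) (Fin k) ℝ := M.adjugate * A.submatrix id b
  have hB : ∀ i j, B i j = (A.submatrix id (Function.update a i (b j))).det := by
    intro i j
    have : B i j = M.cramer (fun r => A r (b j)) i := by
      rw [Matrix.cramer_eq_adjugate_mulVec]; rfl
    rw [this, Matrix.cramer_apply]
    congr 1
    ext r c
    by_cases hc : c = i
    · subst hc; simp
    · simp [hc, hM]
  have hB0 : ∀ i j, ¬ p j → B i j = if i = j then M.det else 0 := by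
    intro i j hj
    have : B i j = (M.adjugate * M) i j := by
      simp only [B, Matrix.mul_apply, hM, Matrix.submatrix_apply, hfix j hj]
    rw [this, Matrix.adjugate_mul, Matrix.smul_apply, Matrix.one_apply]
    simp
  have hdet1 : B.det = M.det ^ (k - 1) * (A.submatrix id b).det := by
    simp [B, Matrix.det_mul, Matrix.det_adjugate]
  have hblock : (Matrix.toSquareBlockProp B fun i => ¬ p i).det
      = M.det ^ (Fintype.card {q // ¬ p q}) := by
    have : (Matrix.toSquareBlockProp B fun i => ¬ p i) =
        M.det • (1 : Matrix {q // ¬ p q} {q // ¬ p q} ℝ) := by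
      ext i j
      rw [Matrix.toSquareBlockProp_def]
      simp [hB0 _ _ j.2, Matrix.one_apply, Subtype.ext_iff]
    rw [this, Matrix.det_smul]; simp
  have hdet2 := B.twoBlockTriangular_det' p (by
    intro i hi j hj
    rw [hB0 i j hj, if_neg]
    rintro rfl; exact hj hi)
  rw [hdet1, hblock] at hdet2
  have hcard : Fintype.card T + Fintype.card {q // ¬ p q} = k := by
    rw [Fintype.card_congr e, Fintype.card_subtype_compl]
    have := Fintype.card_subtype_le p
    simp only [Fintype.card_fin] at *
    omega
  have hk : k - 1 = (Fintype.card T - 1) + Fintype.card {q // ¬ p q} := by omega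
  rw [hk, pow_add] at hdet2
  have hne : M.det ^ (Fintype.card {q // ¬ p q}) ≠ 0 := pow_ne_zero _ hd
  have hmain : (A.submatrix id b).det * M.det ^ (Fintype.card T - 1) =
      (Matrix.toSquareBlockProp B p).det := by
    apply mul_right_cancel₀ hne
    rw [← hdet2]; ring
  rw [hmain, ← Matrix.det_submatrix_equiv_self e, ← Matrix.det_transpose, Matrix.det_apply']
  refine Finset.sum_congr rfl fun σ _ => ?_
  congr 1
  refine Finset.prod_congr rfl fun t _ => ?_
  rw [← hB]
  rfl

theorem pminor_continuous {k n : ℕ} (S : Finset (Fin n)) (F : ℝ → Matrix (Fin k) (Fin n) ℝ)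
    (hF : Continuous F) : Continuous fun t => pminor (F t) S := by
  unfold pminor
  split_ifs with h
  · exact (hF.matrix_submatrix _ _).matrix_det
  · exact continuous_const

open Classical in
/-- The identity when `Δ_I ≠ 0`. -/
theorem plucker_nondeg (k n : ℕ) (A : Matrix (Fin k) (Fin n) ℝ)
    (I J : Finset (Fin n)) (hI : I.card = k) (hJ : J.card = k) (hne : I ≠ J)
    (hd : pminor A I ≠ 0) :
    pminor A J * pminor A I ^ ((I \ J).card - 1) =
      ∑ π : {x // x ∈ I \ J} ≃ {x // x ∈ J \ I},
        (-1 : ℝ) ^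
          (Finset.univ.filter (fun p : {x // x ∈ I \ J} × {x // x ∈ I \ J} =>
            (p.1 : Fin n) < (p.2 : Fin n) ∧
            chordsCross (p.1 : Fin n) ((π p.1 : Fin n)) (p.2 : Fin n) ((π p.2 : Fin n)))).card *
        ∏ i : {x // x ∈ I \ J}, pminor A (insert ((π i : Fin n)) (I.erase (i : Fin n))) := by
  set a : Fin k → Fin n := ⇑(I.orderEmbOfFin hI) with ha_def
  have ha : StrictMono a := (I.orderEmbOfFin hI).strictMono
  have haI : ∀ q, a q ∈ I := fun q => I.orderEmbOfFin_mem hI q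
  have haim : Finset.univ.image a = I := by
    ext x
    have := I.range_orderEmbOfFin hI
    have h2 : x ∈ Set.range a ↔ x ∈ I := by rw [ha_def, this]; simp
    simpa using h2
  have hex : ∀ x ∈ I, ∃ q, a q = x := by
    intro x hx
    rw [← haim] at hx
    simpa using hx
  let p : Fin k → Prop := fun q => a q ∈ I \ J
  let e : {q // p q} ≃ {x // x ∈ I \ J} := Equiv.ofBijective (fun q => ⟨a q.1, q.2⟩) (by
    constructor
    · intro q q' h
      have h' : a q.1 = a q'.1 := by simpa only [Subtype.mk.injEq] using h
      exact Subtype.ext (ha.injective h')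
    · rintro ⟨x, hx⟩
      obtain ⟨q, rfl⟩ := hex x (Finset.mem_sdiff.1 hx).1
      exact ⟨⟨q, hx⟩, rfl⟩)
  have hae : ∀ x, a (e.symm x).1 = x := fun x =>
    congrArg Subtype.val (e.apply_symm_apply x)
  have hcardKL : Fintype.card {x // x ∈ I \ J} = Fintype.card {x // x ∈ J \ I} := by
    rw [Fintype.card_coe, Fintype.card_coe]
    have h1 := Finset.card_sdiff_add_card_inter I J
    have h2 := Finset.card_sdiff_add_card_inter J I
    rw [Finset.inter_comm] at h2
    omega
  have hpos : 0 < Fintype.card {x // x ∈ I \ J} := by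
    rw [Fintype.card_coe, Finset.card_pos, Finset.sdiff_nonempty]
    intro h
    exact hne (Finset.eq_of_subset_of_card_le h (by omega))
  let π₀ : {x // x ∈ I \ J} ≃ {x // x ∈ J \ I} := Fintype.equivOfCardEq hcardKL
  let ext : ({x // x ∈ I \ J} ≃ {x // x ∈ J \ I}) → Fin k → Fin n :=
    fun π q => if h : p q then (π (e ⟨q, h⟩) : Fin n) else a q
  have ext_pos : ∀ π x, ext π (e.symm x).1 = π x := by
    intro π x
    simp only [ext]
    rw [dif_pos (e.symm x).2]
    simp
  have ext_neg : ∀ π q, ¬ p q → ext π q = a q := by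
    intro π q h
    simp only [ext]
    rw [dif_neg h]
  have hcase : ∀ q, ¬ p q ∨ ∃ x, q = (e.symm x).1 := by
    intro q
    by_cases h : p q
    · right; exact ⟨e ⟨q, h⟩, by simp⟩
    · left; exact h
  have hπJ : ∀ (π : {x // x ∈ I \ J} ≃ {x // x ∈ J \ I}) x, (π x : Fin n) ∈ J ∧ (π x : Fin n) ∉ I :=
    fun π x => Finset.mem_sdiff.1 (π x).2
  have hmv : ∀ (π : {x // x ∈ I \ J} ≃ {x // x ∈ J \ I}) x q, a q ≠ ext π (e.symm x).1 := by
    intro π x q h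
    rw [ext_pos] at h
    exact (hπJ π x).2 (h ▸ haI q)
  have ext_inj : ∀ π, Function.Injective (ext π) := by
    intro π q q' h
    rcases hcase q with hq | ⟨x, rfl⟩
    · rcases hcase q' with hq' | ⟨x', rfl⟩
      · rw [ext_neg π q hq, ext_neg π q' hq'] at h
        exact ha.injective h
      · rw [ext_neg π q hq] at h
        exact absurd h (hmv π x' q)
    · rcases hcase q' with hq' | ⟨x', rfl⟩
      · rw [ext_neg π q' hq'] at h
        exact absurd h.symm (hmv π x q')
      · rw [ext_pos, ext_pos] at h
        rw [π.injective (Subtype.ext h)]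
  have ext_im : ∀ π, Finset.univ.image (ext π) = J := by
    intro π
    apply Finset.eq_of_subset_of_card_le
    · intro y hy
      obtain ⟨q, -, rfl⟩ := Finset.mem_image.1 hy
      rcases hcase q with hq | ⟨x, rfl⟩
      · rw [ext_neg π q hq]
        by_contra hJ'
        exact hq (Finset.mem_sdiff.2 ⟨haI q, hJ'⟩)
      · rw [ext_pos]; exact (hπJ π x).1
    · rw [Finset.card_image_of_injective _ (ext_inj π)]; simp [hJ]
  have hminI : pminor A I = (A.submatrix id a).det := pminor_eq A I hI
  have hminJ : pminor A J = wordSgn (ext π₀) * (A.submatrix id (ext π₀)).det :=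
    pminor_eq_word A J _ (ext_inj π₀) (ext_im π₀)
  have hminS : ∀ (π : {x // x ∈ I \ J} ≃ {x // x ∈ J \ I}) x,
      pminor A (insert ((π x : Fin n)) (I.erase (x : Fin n))) =
      wordSgn (Function.update a (e.symm x).1 (ext π (e.symm x).1)) *
        (A.submatrix id (Function.update a (e.symm x).1 (ext π (e.symm x).1))).det := by
    intro π x
    apply pminor_eq_word
    · intro q q' h
      by_cases h1 : q = (e.symm x).1
      · by_cases h2 : q' = (e.symm x).1
        · rw [h1, h2]
        · subst h1
          rw [Function.update_self, Function.update_of_ne h2] at h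
          exact absurd h.symm (hmv π x q')
      · by_cases h2 : q' = (e.symm x).1
        · subst h2
          rw [Function.update_self, Function.update_of_ne h1] at h
          exact absurd h (hmv π x q)
        · rw [Function.update_of_ne h1, Function.update_of_ne h2] at h
          exact ha.injective h
    · ext y
      simp only [Finset.mem_image, Finset.mem_univ, true_and, Finset.mem_insert, Finset.mem_erase]
      constructor
      · rintro ⟨q, rfl⟩
        by_cases h1 : q = (e.symm x).1
        · subst h1
          left; rw [Function.update_self, ext_pos]
        · right
          rw [Function.update_of_ne h1]
          refine ⟨?_, haI q⟩
          rw [← hae x]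
          exact ha.injective.ne h1
      · rintro (rfl | ⟨h1, h2⟩)
        · exact ⟨(e.symm x).1, by rw [Function.update_self, ext_pos]⟩
        · obtain ⟨q, rfl⟩ := hex y h2
          refine ⟨q, Function.update_of_ne ?_ _ _⟩
          rintro rfl
          exact h1 (hae x)
  have hsign : ∀ σ : Equiv.Perm {x // x ∈ I \ J},
      wordSgn (ext (σ.trans π₀)) = (Equiv.Perm.sign σ : ℤ) * wordSgn (ext π₀) := by
    intro σ
    have : ext (σ.trans π₀) = ext π₀ ∘ (σ.extendDomain e.symm) := by
      funext q
      rcases hcase q with hq | ⟨x, rfl⟩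
      · rw [Function.comp_apply, Equiv.Perm.extendDomain_apply_not_subtype _ _ hq,
          ext_neg _ _ hq, ext_neg _ _ hq]
      · rw [Function.comp_apply, Equiv.Perm.extendDomain_apply_image, ext_pos, ext_pos]
        rfl
    rw [this, wordSgn_comp, Equiv.Perm.sign_extendDomain]
  have hkey := det_identity A a (ext π₀) p e.symm (fun q hq => ext_neg π₀ q hq) hpos
    (hminI ▸ hd)
  rw [Fintype.card_coe] at hkey
  rw [hminJ, hminI, mul_assoc, hkey, Finset.mul_sum]
  let E : Equiv.Perm {x // x ∈ I \ J} ≃ ({x // x ∈ I \ J} ≃ {x // x ∈ J \ I}) :=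
    Equiv.equivCongr (Equiv.refl _) π₀
  have hE : ∀ σ, E σ = σ.trans π₀ := fun σ => by ext; rfl
  rw [← Equiv.sum_comp E]
  refine Finset.sum_congr rfl fun σ _ => ?_
  rw [hE]
  rw [Finset.prod_congr rfl (fun x _ => hminS (σ.trans π₀) x), Finset.prod_mul_distrib]
  have hS := sign_identity a (ext (σ.trans π₀)) ha (ext_inj _) (fun x => (e.symm x).1)
    (fun x y h => e.symm.injective (Subtype.ext h))
    (fun q hq => by
      rcases hcase q with h | ⟨x, rfl⟩
      · exact ext_neg _ _ h
      · exact absurd ⟨x, rfl⟩ hq)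
    (fun t q => hmv _ t q)
  simp only [hae, ext_pos] at hS
  simp only [ext_pos] at hS ⊢
  rw [← hS, hsign]
  have hW : (∏ x : {x // x ∈ I \ J}, wordSgn (Function.update a (e.symm x).1
      ((σ.trans π₀) x : Fin n))) * (∏ x : {x // x ∈ I \ J}, wordSgn (Function.update a (e.symm x).1
      ((σ.trans π₀) x : Fin n))) = 1 := by
    rw [← Finset.prod_mul_distrib]
    refine Finset.prod_eq_one fun x _ => wordSgn_sq _ ?_
    intro q q' h
    have hx : ∀ q, a q ≠ (σ.trans π₀) x := fun q h => (hπJ (σ.trans π₀) x).2 (h ▸ haI q)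
    by_cases h1 : q = (e.symm x).1
    · by_cases h2 : q' = (e.symm x).1
      · rw [h1, h2]
      · subst h1
        rw [Function.update_self, Function.update_of_ne h2] at h
        exact absurd h.symm (hx q')
    · by_cases h2 : q' = (e.symm x).1
      · subst h2
        rw [Function.update_self, Function.update_of_ne h1] at h
        exact absurd h (hx q)
      · rw [Function.update_of_ne h1, Function.update_of_ne h2] at h
        exact ha.injective h
  simp only [Equiv.trans_apply] at hW ⊢
  linear_combination (-(Equiv.Perm.sign σ : ℤ) * wordSgn (ext π₀) *
    (∏ x : {x // x ∈ I \ J}, (A.submatrix id (Function.update a (e.symm x).1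
      (π₀ (σ x) : Fin n))).det)) * hW

open Classical in
/-- Lemma on Plücker coordinates: for `k`-subsets `I ≠ J` of `[n]` with `K = I \ J`,
`L = J \ I`, `r = |K|`, one has
`Δ_J · Δ_I^{r-1} = Σ_{π : K → L} (-1)^{xing(π)} Π_{i ∈ K} Δ_{(I \ {i}) ∪ {π(i)}}`,
the sum being over all bijections `π : K → L` and `xing(π)` the number of crossings of `π`. -/
theorem plucker_coordinate_identity (k n : ℕ) (A : Matrix (Fin k) (Fin n) ℝ)
    (I J : Finset (Fin n)) (hI : I.card = k) (hJ : J.card = k) (hne : I ≠ J) :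
    pminor A J * pminor A I ^ ((I \ J).card - 1) =
      ∑ π : {x // x ∈ I \ J} ≃ {x // x ∈ J \ I},
        (-1 : ℝ) ^
          (Finset.univ.filter (fun p : {x // x ∈ I \ J} × {x // x ∈ I \ J} =>
            (p.1 : Fin n) < (p.2 : Fin n) ∧
            chordsCross (p.1 : Fin n) ((π p.1 : Fin n)) (p.2 : Fin n) ((π p.2 : Fin n)))).card *
        ∏ i : {x // x ∈ I \ J}, pminor A (insert ((π i : Fin n)) (I.erase (i : Fin n))) := by
  set a : Fin k → Fin n := ⇑(I.orderEmbOfFin hI) with ha_def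
  have ha : StrictMono a := (I.orderEmbOfFin hI).strictMono
  let E : Matrix (Fin k) (Fin n) ℝ := Matrix.of fun i c => if a i = c then 1 else 0
  let F : ℝ → Matrix (Fin k) (Fin n) ℝ := fun t => A + t • E
  have hF : Continuous F := by fun_prop
  have hdet : ∀ t, pminor (F t) I = (-(A.submatrix id a)).charpoly.eval t := by
    intro t
    rw [pminor_eq _ I hI, Matrix.eval_charpoly]
    congr 1
    ext i j
    simp only [F, E, Matrix.submatrix_apply, Matrix.add_apply, Matrix.smul_apply, Matrix.of_apply,
      Matrix.sub_apply, Matrix.neg_apply, Matrix.scalar_apply, Matrix.diagonal_apply, id,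
      ← ha_def, ha.injective.eq_iff]
    split_ifs <;> simp [add_comm]
  have hdense : Dense {t : ℝ | pminor (F t) I ≠ 0} := by
    have hfin : {t : ℝ | pminor (F t) I = 0}.Finite := by
      have hne0 : (-(A.submatrix id a)).charpoly ≠ 0 := (Matrix.charpoly_monic _).ne_zero
      refine (Polynomial.finite_setOf_isRoot hne0).subset ?_
      intro t ht
      rw [Set.mem_setOf_eq, hdet] at ht
      exact ht
    have := (dense_univ (X := ℝ)).sdiff_finite hfin
    refine this.mono ?_
    rintro t ⟨-, ht⟩
    exact ht
  have hfun := Continuous.ext_on hdense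
    (f := fun t => pminor (F t) J * pminor (F t) I ^ ((I \ J).card - 1))
    (g := fun t => ∑ π : {x // x ∈ I \ J} ≃ {x // x ∈ J \ I},
        (-1 : ℝ) ^
          (Finset.univ.filter (fun p : {x // x ∈ I \ J} × {x // x ∈ I \ J} =>
            (p.1 : Fin n) < (p.2 : Fin n) ∧
            chordsCross (p.1 : Fin n) ((π p.1 : Fin n)) (p.2 : Fin n) ((π p.2 : Fin n)))).card *
        ∏ i : {x // x ∈ I \ J}, pminor (F t) (insert ((π i : Fin n)) (I.erase (i : Fin n))))
    ((pminor_continuous J F hF).mul ((pminor_continuous I F hF).pow _))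
    (continuous_finsetSum _ fun π _ => continuous_const.mul
      (continuous_finsetProd _ fun i _ => pminor_continuous _ F hF))
    (fun t ht => plucker_nondeg k n (F t) I J hI hJ hne ht)
  have h0 := congrFun hfun 0
  have hF0 : F 0 = A := by simp [F]
  simpa only [hF0] using h0
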